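/- Let W be a simply-laced Weyl group, π a dominant integral weight with Stab_W(π) = W_P, and let v ≤ w be π-minuscule elements in W^P such that w v^{−1} is π′-minuscule for some dominant integral weight π′. Then for every z ∈ [v,w]^P, one has S(z/v) = S(z v^{−1}), i.e. {β ∈ R^+ : v ≤ s_β z < z} = {β ∈ R^+ : s_β (z v^{−1}) < z v^{−1}}. -/

import Mathlib

open scoped Classical BigOperators

/-- A bundled setting for a finite crystallographic root system together with its
Weyl group, its action on the rational span of the weight lattice, reflections,
and the data of coefficients of roots in the basis of simple roots. -/
structure WeylSetting where
  /-- index set of the Dynkin diagram (simple roots) -/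
  I : Type
  [fintypeI : Fintype I]
  [decEqI : DecidableEq I]
  /-- rational span of the weight lattice -/
  V : Type
  [acg : AddCommGroup V]
  [mod : Module ℚ V]
  /-- the Weyl group -/
  W : Type
  [grp : Group W]
  /-- the action of the Weyl group on weights -/
  act : W →* (V ≃ₗ[ℚ] V)
  /-- the simple roots -/
  simple : I → V
  /-- the (finite) set of roots -/
  roots : Finset V
  /-- `coroot β μ` is the pairing `⟨μ, β∨⟩` -/
  coroot : V → (V →ₗ[ℚ] ℚ)
  /-- the reflection `s_β ∈ W` associated to a root `β` -/
  srefl : V → W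
  /-- coefficients of a positive root in the basis of simple roots -/
  posCoeff : V → I → ℕ
  simple_mem : ∀ i, simple i ∈ roots
  simple_indep : LinearIndependent ℚ simple
  roots_neg : ∀ β ∈ roots, -β ∈ roots
  root_pos_or_neg : ∀ β ∈ roots,
    (∃ c : I → ℚ, (∀ i, 0 ≤ c i) ∧ β = ∑ i, c i • simple i) ∨
    (∃ c : I → ℚ, (∀ i, 0 ≤ c i) ∧ -β = ∑ i, c i • simple i)
  coroot_self : ∀ β ∈ roots, coroot β β = 2
  crystallographic : ∀ β ∈ roots, ∀ γ ∈ roots, ∃ n : ℤ, coroot β γ = n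
  posCoeff_spec : ∀ β ∈ roots,
    (∃ c : I → ℚ, (∀ i, 0 ≤ c i) ∧ β = ∑ i, c i • simple i) →
    β = ∑ i, (posCoeff β i : ℚ) • simple i
  srefl_apply : ∀ β ∈ roots, ∀ v : V, act (srefl β) v = v - coroot β v • β
  act_faithful : ∀ g : W, (∀ v : V, act g v = v) → g = 1
  roots_invariant : ∀ g : W, ∀ β ∈ roots, act g β ∈ roots
  coroot_equivariant : ∀ g : W, ∀ β ∈ roots, ∀ v : V,
    coroot (act g β) (act g v) = coroot β v
  generated : ∀ g : W, ∃ l : List I, g = (l.map fun i => srefl (simple i)).prod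

namespace WeylSetting

attribute [instance] fintypeI decEqI acg mod grp

variable (D : WeylSetting)

/-- the simple reflection attached to a node of the Dynkin diagram -/
def s (i : D.I) : D.W := D.srefl (D.simple i)

/-- the product `s_{i_1} ⋯ s_{i_r}` of the simple reflections listed in `l` -/
def wordProd (l : List D.I) : D.W := (l.map D.s).prod

/-- `β` is a positive root: a root which is a nonnegative combination of simple roots -/
def IsPosRoot (β : D.V) : Prop :=
  β ∈ D.roots ∧ ∃ c : D.I → ℚ, (∀ i, 0 ≤ c i) ∧ β = ∑ i, c i • D.simple i

/-- the length of a Weyl group element -/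
noncomputable def length (g : D.W) : ℕ :=
  sInf {n | ∃ l : List D.I, l.length = n ∧ D.wordProd l = g}

/-- `l` is a reduced word for `g` -/
def IsReduced (l : List D.I) (g : D.W) : Prop :=
  D.wordProd l = g ∧ l.length = D.length g

/-- the number of reduced words of `g` -/
noncomputable def RedCard (g : D.W) : ℕ := Nat.card {l : List D.I // D.IsReduced l g}

/-- the (strong) Bruhat order on the Weyl group -/
def bruhatLE : D.W → D.W → Prop :=
  Relation.ReflTransGen
    (fun a b => (∃ β, D.IsPosRoot β ∧ b = D.srefl β * a) ∧ D.length a < D.length b)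

/-- strict (strong) Bruhat order -/
def bruhatLT (a b : D.W) : Prop := D.bruhatLE a b ∧ a ≠ b

/-- the left weak Bruhat order: `a ≤_L b` iff `ℓ(b a⁻¹) + ℓ(a) = ℓ(b)` -/
def weakLE (a b : D.W) : Prop := D.length (b * a⁻¹) + D.length a = D.length b

/-- the height of a positive root: the sum of its coefficients in the simple roots -/
noncomputable def ht (β : D.V) : ℕ := ∑ i, D.posCoeff β i

/-- an integral weight: the pairings with all positive coroots are integers -/
def IsIntegral (lam : D.V) : Prop :=
  ∀ β, D.IsPosRoot β → ∃ n : ℤ, D.coroot β lam = n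

/-- a dominant integral weight -/
def IsDominant (lam : D.V) : Prop :=
  D.IsIntegral lam ∧ ∀ i, 0 ≤ D.coroot (D.simple i) lam

/-- a pre-dominant integral weight: `⟨λ, β∨⟩ ≥ -1` for all positive roots `β` -/
def IsPreDominant (lam : D.V) : Prop :=
  D.IsIntegral lam ∧ ∀ β, D.IsPosRoot β → -1 ≤ D.coroot β lam

/-- the diagram `D(λ) = {β ∈ R⁺ : ⟨λ, β∨⟩ = -1}` of a pre-dominant weight -/
noncomputable def diagram (lam : D.V) : Finset D.V :=
  D.roots.filter fun β => D.IsPosRoot β ∧ D.coroot β lam = -1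

/-- `IsWeightPath λ [β₁, …, β_r]` says that
`λ = λ₀ →β₁ λ₁ →β₂ ⋯ →β_r λ_r` is a `λ`-path, i.e. each `β_j` is a positive
root, `⟨λ_{j-1}, β_j∨⟩ = -1` and `λ_j = s_{β_j}(λ_{j-1})`. -/
def IsWeightPath : D.V → List D.V → Prop
  | _, [] => True
  | lam, β :: rest =>
      D.IsPosRoot β ∧ D.coroot β lam = -1 ∧
        IsWeightPath (D.act (D.srefl β) lam) rest

/-- the term `1/β₁ ⋅ 1/(β₁+β₂) ⋅ … ⋅ 1/(β₁+⋯+β_r)` attached to a path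
`(β₁, …, β_r)`, computed in a field `F` via a linear embedding `emb`. -/
noncomputable def pathTerm {F : Type} [Field F] [Algebra ℚ F]
    (emb : D.V →ₗ[ℚ] F) (l : List D.V) : F :=
  ∏ j ∈ Finset.range l.length, (emb ((l.take (j + 1)).sum))⁻¹

/-- `w` is a π-minuscule element (in the sense of Peterson). -/
def IsMinuscule (pi : D.V) (w : D.W) : Prop :=
  ∃ l : List D.I, D.IsReduced l w ∧
    ∀ k : Fin l.length,
      D.coroot (D.simple (l.get k)) (D.act (D.wordProd (l.drop (k.val + 1))) pi) = 1

/-- the stabilizer `W_π = Stab_W(π)` of a weight -/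
def stab (pi : D.V) : Subgroup D.W where
  carrier := {g | D.act g pi = pi}
  one_mem' := by simp
  mul_mem' := by
    intro a b ha hb
    simp only [Set.mem_setOf_eq] at *
    calc D.act (a * b) pi = D.act a (D.act b pi) := by rw [map_mul]; rfl
    _ = pi := by rw [hb, ha]
  inv_mem' := by
    intro a ha
    simp only [Set.mem_setOf_eq] at *
    calc D.act a⁻¹ pi = D.act a⁻¹ (D.act a pi) := by rw [ha]
    _ = D.act (a⁻¹ * a) pi := by rw [map_mul]; rfl
    _ = pi := by simp

/-- `u` is the minimal-length representative of its coset `uH` -/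
def IsMinRep (H : Subgroup D.W) (u : D.W) : Prop :=
  ∀ g : D.W, u⁻¹ * g ∈ H → D.length u ≤ D.length g

/-- `a` and `b` lie in the same coset of `H`, i.e. `aH = bH` -/
def SameCoset (H : Subgroup D.W) (a b : D.W) : Prop := a⁻¹ * b ∈ H

/-- `u →β w` in `W^P`: `β` is a positive root, `u, w` are minimal-length
representatives, `s_β w H = u H`, and `u < w` in Bruhat order -/
def Arrow (H : Subgroup D.W) (u w : D.W) (β : D.V) : Prop :=
  D.IsPosRoot β ∧ D.IsMinRep H u ∧ D.IsMinRep H w ∧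
    D.SameCoset H (D.srefl β * w) u ∧ D.bruhatLT u w

/-- `ArrowPath H w [β₁, …, β_r]` encodes a directed path
`x_r →β_r ⋯ → x_1 →β₁ x_0 = w` in the Bruhat graph on `W^P`. -/
def ArrowPath (H : Subgroup D.W) : D.W → List D.V → Prop
  | _, [] => True
  | w, β :: rest => ∃ u, D.Arrow H u w β ∧ ArrowPath H u rest

/-- directed paths as above whose vertices all lie above `v` in Bruhat order -/
def ArrowPathGE (H : Subgroup D.W) (v : D.W) : D.W → List D.V → Prop
  | _, [] => True
  | w, β :: rest => ∃ u, D.Arrow H u w β ∧ D.bruhatLE v u ∧ ArrowPathGE H v u rest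

/-- directed paths from `u` to `w`:
`u = x_r →β_r ⋯ → x_1 →β₁ x_0 = w` encoded by the list `[β₁, …, β_r]`. -/
def ArrowPathFromTo (H : Subgroup D.W) (u : D.W) : D.W → List D.V → Prop
  | w, [] => u = w
  | w, β :: rest => ∃ x, D.Arrow H x w β ∧ ArrowPathFromTo H u x rest

/-- `S(w) = {β ∈ R⁺ : s_β w < w}` -/
noncomputable def Sset (w : D.W) : Finset D.V :=
  D.roots.filter fun β => D.IsPosRoot β ∧ D.bruhatLT (D.srefl β * w) w

/-- `S(w/v) = {β ∈ R⁺ : v ≤ s_β w < w}` -/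
noncomputable def SsetSkew (v w : D.W) : Finset D.V :=
  D.roots.filter fun β =>
    D.IsPosRoot β ∧ D.bruhatLE v (D.srefl β * w) ∧ D.bruhatLT (D.srefl β * w) w

/-- an oriented edge `x → y` in the Bruhat graph of `G/P`: `x, y` are minimal
representatives, `xH < yH`, and `yH = x s_γ H` for some positive root `γ` -/
def GEdge (H : Subgroup D.W) (x y : D.W) : Prop :=
  D.IsMinRep H x ∧ D.IsMinRep H y ∧ D.bruhatLT x y ∧
    ∃ γ, D.IsPosRoot γ ∧ D.SameCoset H (x * D.srefl γ) y

/-- the (unique) positive root `γ` with `yH = x s_γ H` attached to an edge -/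
noncomputable def edgeRoot (H : Subgroup D.W) (x y : D.W) : D.V :=
  if h : ∃ γ, D.IsPosRoot γ ∧ D.SameCoset H (x * D.srefl γ) y then h.choose else 0

/-- `GChainTo H v t [x₁, …, x_r]` encodes a directed path
`v ≤ x_r → ⋯ → x_1 → x_0 = t` in the Bruhat graph of `G/P` -/
def GChainTo (H : Subgroup D.W) (v : D.W) : D.W → List D.W → Prop
  | _, [] => True
  | t, x :: rest => D.GEdge H x t ∧ D.bruhatLE v x ∧ GChainTo H v x rest

/-- the weighted term
`(m_Λ(x_r,x_{r-1})/W_Λ(x_r)) ⋯ (m_Λ(x_1,x_0)/W_Λ(x_1))` of a path in the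
`Λ`-Bruhat graph, computed in a field `F` via a linear embedding `emb`. -/
noncomputable def chainTerm {F : Type} [Field F] [Algebra ℚ F]
    (emb : D.V →ₗ[ℚ] F) (H : Subgroup D.W) (Lam : D.W → D.V) (w : D.W) :
    D.W → List D.W → F
  | _, [] => 1
  | t, x :: rest =>
      algebraMap ℚ F (D.coroot (D.edgeRoot H x t) (Lam x)) *
        (emb (D.act x (Lam x) - D.act w (Lam x)))⁻¹ *
        chainTerm emb H Lam w x rest

/-- the Bruhat order on cosets: `aH ≤ bH` -/
def cosetLE (H : Subgroup D.W) (a b : D.W) : Prop :=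
  ∃ x y, D.SameCoset H a x ∧ D.SameCoset H b y ∧ D.bruhatLE x y

/-- the (standard) parabolic subgroup generated by simple reflections in `J` -/
def parab (J : Set D.I) : Subgroup D.W := Subgroup.closure (D.s '' J)

/-- `X*(T)_P`: integral weights orthogonal to all coroots of `W_P`,
i.e. to `γ∨` for all positive roots `γ` in the span of the simple roots of `P` -/
def OrthWeightP (J : Set D.I) (lam : D.V) : Prop :=
  D.IsIntegral lam ∧
    ∀ γ, D.IsPosRoot γ → γ ∈ Submodule.span ℚ (D.simple '' J) → D.coroot γ lam = 0

/-- an admissible function `Λ : [v,w]^P → X*(T)_P` -/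
def Admissible (J : Set D.I) (v w : D.W) (Lam : D.W → D.V) : Prop :=
  (∀ x, D.IsMinRep (D.parab J) x → D.bruhatLE v x → D.bruhatLE x w →
      D.OrthWeightP J (Lam x)) ∧
  (∀ x, D.IsMinRep (D.parab J) x → D.bruhatLE v x → D.bruhatLE x w → x ≠ w →
      D.act x (Lam x) ≠ D.act w (Lam x))

/-- the subword of `l` with letters at the positions in `S`, in increasing order -/
def subwordF (l : List D.I) (S : Finset (Fin l.length)) : List D.I :=
  ((List.finRange l.length).filter fun j => j ∈ S).map l.get

/-- `β_j = s_{i_1} ⋯ s_{i_{j-1}}(α_{i_j})` attached to a reduced word `l` -/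
noncomputable def refRoot (l : List D.I) (j : Fin l.length) : D.V :=
  D.act (D.wordProd (l.take j.val)) (D.simple (l.get j))

/-- the Weyl group is simply laced: the Cartan pairing is symmetric -/
def SimplyLaced : Prop :=
  ∀ i j, D.coroot (D.simple i) (D.simple j) = D.coroot (D.simple j) (D.simple i)

/-- generating relation of the heap order of the word `l`:
`p_j < p_k` whenever `j < k` and `s_{i_j}`, `s_{i_k}` do not commute -/
def heapCovers (l : List D.I) (j k : Fin l.length) : Prop :=
  (j : ℕ) < (k : ℕ) ∧ D.s (l.get j) * D.s (l.get k) ≠ D.s (l.get k) * D.s (l.get j)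

/-- the heap order of the word `l`: the minimal partial order generated by
`heapCovers` -/
def heapLE (l : List D.I) : Fin l.length → Fin l.length → Prop :=
  Relation.ReflTransGen (D.heapCovers l)

/-- strict heap order -/
def heapLT (l : List D.I) (j k : Fin l.length) : Prop := D.heapLE l j k ∧ j ≠ k

/-- `F` is an order filter of the heap `H(w)` of the word `l` -/
def IsHeapFilter (l : List D.I) (F : Finset (Fin l.length)) : Prop :=
  ∀ j k, j ∈ F → D.heapLE l j k → k ∈ F

/-- `i` and `j` are joined by an edge of the Dynkin diagram -/
def adjDynkin (i j : D.I) : Prop := i ≠ j ∧ D.s i * D.s j ≠ D.s j * D.s i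

/-- an elementary excitation `A ▷ B` of subsets of the heap of the word `l` -/
def Excite (l : List D.I) (A B : Finset (Fin l.length)) : Prop :=
  ∃ p q, D.heapLT l p q ∧ l.get p = l.get q ∧ q ∈ A ∧ p ∈ B ∧
    A.erase q = B.erase p ∧
    (∀ z, D.heapLT l p z → D.heapLT l z q → l.get z ≠ l.get p) ∧
    ∀ u ∈ A, D.heapLE l p u → D.heapLE l u q → ¬ D.adjDynkin (l.get p) (l.get u)

/-- `A` is an excited diagram of `F` in the heap of the word `l`,
i.e. `A ∈ E_{H(w)}(F)` -/
def InExcited (l : List D.I) (F A : Finset (Fin l.length)) : Prop :=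
  Relation.ReflTransGen (D.Excite l) F A

end WeylSetting

namespace WeylSetting

section Aux

variable {D : WeylSetting}

theorem act_mul' (a b : D.W) (x : D.V) : D.act (a * b) x = D.act a (D.act b x) := by
  rw [map_mul]; rfl

theorem act_one' (x : D.V) : D.act 1 x = x := by simp

theorem act_inv_act (a : D.W) (x : D.V) : D.act a⁻¹ (D.act a x) = x := by
  rw [← act_mul']; simp

theorem act_act_inv (a : D.W) (x : D.V) : D.act a (D.act a⁻¹ x) = x := by
  rw [← act_mul']; simp

theorem act_ext {a b : D.W} (h : ∀ x, D.act a x = D.act b x) : a = b := by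
  have : b⁻¹ * a = 1 := D.act_faithful _ (fun x => by rw [act_mul', h, act_inv_act])
  exact (inv_mul_eq_one.mp this).symm

theorem s_apply (i : D.I) (x : D.V) :
    D.act (D.s i) x = x - D.coroot (D.simple i) x • D.simple i :=
  D.srefl_apply _ (D.simple_mem i) x

theorem srefl_mul_self {β : D.V} (hβ : β ∈ D.roots) : D.srefl β * D.srefl β = 1 := by
  apply D.act_faithful
  intro x
  rw [act_mul', D.srefl_apply β hβ, D.srefl_apply β hβ]
  simp only [map_sub, map_smul, D.coroot_self β hβ, smul_eq_mul]
  module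

theorem s_mul_self (i : D.I) : D.s i * D.s i = 1 := srefl_mul_self (D.simple_mem i)

theorem s_mul_cancel (i : D.I) (g : D.W) : D.s i * (D.s i * g) = g := by
  rw [← mul_assoc, s_mul_self, one_mul]

theorem s_inv (i : D.I) : (D.s i)⁻¹ = D.s i := inv_eq_of_mul_eq_one_left (s_mul_self i)

theorem srefl_inv {β : D.V} (hβ : β ∈ D.roots) : (D.srefl β)⁻¹ = D.srefl β :=
  inv_eq_of_mul_eq_one_left (srefl_mul_self hβ)

theorem srefl_conj (g : D.W) {β : D.V} (hβ : β ∈ D.roots) :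
    D.srefl (D.act g β) = g * D.srefl β * g⁻¹ := by
  apply act_ext
  intro x
  rw [D.srefl_apply _ (D.roots_invariant g β hβ), act_mul', act_mul', D.srefl_apply β hβ,
    map_sub, map_smul, act_act_inv, ← D.coroot_equivariant g β hβ, act_act_inv]

theorem srefl_act_self {β : D.V} (hβ : β ∈ D.roots) : D.act (D.srefl β) β = -β := by
  rw [D.srefl_apply β hβ, D.coroot_self β hβ]; module

theorem coord_eq {a b : D.I → ℚ} (h : ∑ i, a i • D.simple i = ∑ i, b i • D.simple i) : a = b := by
  have := Fintype.linearIndependent_iff.mp D.simple_indep (fun i => a i - b i) (by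
    simp [sub_smul, Finset.sum_sub_distrib, h])
  funext i
  have := this i
  linarith

theorem single_sum (i : D.I) (m : ℚ) :
    m • D.simple i = ∑ k, (Pi.single i m : D.I → ℚ) k • D.simple k := by
  rw [Finset.sum_eq_single i]
  · simp
  · intro b _ hb; simp [Pi.single_eq_of_ne hb]
  · simp

theorem pos_or_neg {β : D.V} (hβ : β ∈ D.roots) : D.IsPosRoot β ∨ D.IsPosRoot (-β) := by
  rcases D.root_pos_or_neg β hβ with h | h
  · exact Or.inl ⟨hβ, h⟩
  · exact Or.inr ⟨D.roots_neg β hβ, h⟩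

theorem root_ne_zero {β : D.V} (hβ : β ∈ D.roots) : β ≠ 0 := by
  rintro rfl
  have := D.coroot_self 0 hβ
  simp at this

theorem not_pos_neg {β : D.V} (h : D.IsPosRoot β) (h' : D.IsPosRoot (-β)) : False := by
  obtain ⟨hβ, c, hc, hcβ⟩ := h
  obtain ⟨_, d, hd, hdβ⟩ := h'
  have h0 : ∑ i, (c + d) i • D.simple i = ∑ i, (0 : D.I → ℚ) i • D.simple i := by
    simp only [Pi.add_apply, add_smul, Finset.sum_add_distrib, ← hcβ, ← hdβ]
    simp
  have h1 := coord_eq h0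
  apply root_ne_zero hβ
  rw [hcβ]
  apply Finset.sum_eq_zero
  intro i _
  have h2 := congrFun h1 i
  simp only [Pi.add_apply, Pi.zero_apply] at h2
  have : c i = 0 := by linarith [hc i, hd i]
  rw [this, zero_smul]

theorem pos_simple (i : D.I) : D.IsPosRoot (D.simple i) := by
  refine ⟨D.simple_mem i, Pi.single i 1, ?_, ?_⟩
  · intro k
    by_cases h : k = i
    · subst h; simp
    · simp [Pi.single_eq_of_ne h]
  · rw [← single_sum, one_smul]

/-- A positive root made negative by a simple reflection is a multiple of the simple root. -/
theorem pos_neg_multiple {β : D.V} (h : D.IsPosRoot β) {i : D.I}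
    (h' : D.IsPosRoot (-(D.act (D.s i) β))) : ∃ c : ℕ, c ≠ 0 ∧ β = (c : ℚ) • D.simple i := by
  have hsp := D.posCoeff_spec β h.1 h.2
  obtain ⟨_, d, hd, hdβ⟩ := h'
  rw [s_apply] at hdβ
  have h0 : ∑ k, (fun k => (D.posCoeff β k : ℚ) + d k) k • D.simple k
      = ∑ k, (Pi.single i (D.coroot (D.simple i) β) : D.I → ℚ) k • D.simple k := by
    rw [← single_sum]
    simp only [add_smul, Finset.sum_add_distrib, ← hdβ, ← hsp]
    abel
  have h1 := coord_eq h0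
  have h2 : β = (D.posCoeff β i : ℚ) • D.simple i := by
    conv_lhs => rw [hsp]
    apply Finset.sum_eq_single i
    · intro b _ hb
      have h3 := congrFun h1 b
      simp only [Pi.single_eq_of_ne hb] at h3
      have : (D.posCoeff β b : ℚ) = 0 := by
        have h5 : (0 : ℚ) ≤ D.posCoeff β b := Nat.cast_nonneg _
        linarith [hd b]
      rw [this, zero_smul]
    · simp
  refine ⟨_, ?_, h2⟩
  intro h3
  rw [h3] at h2
  apply root_ne_zero h.1
  rw [h2]; simp

theorem srefl_multiple {β : D.V} (hβ : β ∈ D.roots) {i : D.I} {c : ℚ}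
    (h : β = c • D.simple i) : D.srefl β = D.s i := by
  have hc : D.coroot β (D.simple i) * c = 2 := by
    have := D.coroot_self β hβ
    conv at this => lhs; rw [h]
    rw [map_smul, smul_eq_mul, ← h] at this
    linarith
  have hg : ∀ x, D.act (D.srefl β * D.s i) x =
      x + (D.coroot (D.simple i) x - c * D.coroot β x) • D.simple i := by
    intro x
    rw [act_mul', s_apply, D.srefl_apply β hβ, map_sub, map_smul, smul_eq_mul]
    conv_lhs => enter [2, 2]; rw [h]
    rw [smul_smul]
    have : (D.coroot β x - D.coroot (D.simple i) x * D.coroot β (D.simple i)) * c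
        = D.coroot β x * c - 2 * D.coroot (D.simple i) x := by
      rw [← hc]; ring
    rw [this]
    module
  have hα : D.act (D.srefl β * D.s i) (D.simple i) = D.simple i := by
    rw [hg, D.coroot_self _ (D.simple_mem i), mul_comm c, hc]; simp
  have h1 : D.srefl β * D.s i = 1 := by
    apply D.act_faithful
    intro x
    have h2 := D.coroot_equivariant (D.srefl β * D.s i) (D.simple i) (D.simple_mem i) x
    rw [hα, hg, map_add, map_smul, D.coroot_self _ (D.simple_mem i), smul_eq_mul] at h2
    have h3 : D.coroot (D.simple i) x - c * D.coroot β x = 0 := by linarith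
    rw [hg, h3, zero_smul, add_zero]
  rw [mul_eq_one_iff_eq_inv, s_inv] at h1
  exact h1

theorem pos_dichotomy {β : D.V} (h : D.IsPosRoot β) (i : D.I) :
    D.IsPosRoot (D.act (D.s i) β) ∨ D.srefl β = D.s i := by
  rcases pos_or_neg (D.roots_invariant (D.s i) β h.1) with h1 | h1
  · exact Or.inl h1
  · obtain ⟨c, _, hc⟩ := pos_neg_multiple h h1
    exact Or.inr (srefl_multiple h.1 hc)

theorem wordProd_cons (i : D.I) (l : List D.I) :
    D.wordProd (i :: l) = D.s i * D.wordProd l := by simp [wordProd]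

theorem wordProd_nil : D.wordProd ([] : List D.I) = 1 := by simp [wordProd]

theorem wordProd_append (a b : List D.I) :
    D.wordProd (a ++ b) = D.wordProd a * D.wordProd b := by simp [wordProd]

theorem wordProd_reverse (l : List D.I) : D.wordProd l.reverse = (D.wordProd l)⁻¹ := by
  induction l with
  | nil => simp [wordProd]
  | cons i l ih => simp [wordProd_append, wordProd_cons, wordProd_nil, ih, s_inv]

theorem length_le (l : List D.I) : D.length (D.wordProd l) ≤ l.length :=
  Nat.sInf_le ⟨l, rfl, rfl⟩

theorem exists_reduced (g : D.W) : ∃ l, D.IsReduced l g := by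
  have hne : {n | ∃ l : List D.I, l.length = n ∧ D.wordProd l = g}.Nonempty := by
    obtain ⟨l, hl⟩ := D.generated g
    exact ⟨l.length, l, rfl, hl.symm⟩
  obtain ⟨l, hl, hg⟩ := Nat.sInf_mem hne
  exact ⟨l, hg, hl⟩

/-- Strong exchange. -/
theorem exchange (l : List D.I) : ∀ {β : D.V}, D.IsPosRoot β →
    D.IsPosRoot (-(D.act (D.wordProd l)⁻¹ β)) →
    ∃ j, j < l.length ∧ D.srefl β * D.wordProd l = D.wordProd (l.eraseIdx j) := by
  induction l with
  | nil =>
    intro β h h'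
    rw [wordProd_nil, inv_one, act_one'] at h'
    exact (not_pos_neg h h').elim
  | cons i l ih =>
    intro β h h'
    rcases pos_dichotomy h i with h1 | h1
    · have h2 := ih h1 (by
        rw [wordProd_cons, mul_inv_rev, s_inv, act_mul'] at h'
        exact h')
      obtain ⟨j, hj, hjl⟩ := h2
      refine ⟨j + 1, by simpa using hj, ?_⟩
      rw [List.eraseIdx_cons_succ, wordProd_cons, wordProd_cons, ← hjl, srefl_conj _ h.1, s_inv]
      simp only [mul_assoc]
      rw [s_mul_cancel]
    · refine ⟨0, by simp, ?_⟩
      rw [h1, wordProd_cons, s_mul_cancel]; simp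

theorem length_lt_of_neg {β : D.V} {g : D.W} (h : D.IsPosRoot β)
    (h' : D.IsPosRoot (-(D.act g⁻¹ β))) : D.length (D.srefl β * g) < D.length g := by
  obtain ⟨l, rfl, hl⟩ := exists_reduced g
  obtain ⟨j, hj, hjl⟩ := exchange l h h'
  rw [hjl, ← hl]
  refine (length_le _).trans_lt ?_
  rw [List.length_eraseIdx_of_lt hj]
  omega

theorem length_gt_of_pos {β : D.V} {g : D.W} (h : D.IsPosRoot β)
    (h' : D.IsPosRoot (D.act g⁻¹ β)) : D.length g < D.length (D.srefl β * g) := by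
  have := length_lt_of_neg (g := D.srefl β * g) h (by
    rw [mul_inv_rev, srefl_inv h.1, act_mul', srefl_act_self h.1, map_neg, neg_neg]
    exact h')
  rwa [← mul_assoc, srefl_mul_self h.1, one_mul] at this

theorem neg_of_length_lt {β : D.V} {g : D.W} (h : D.IsPosRoot β)
    (hl : D.length (D.srefl β * g) < D.length g) : D.IsPosRoot (-(D.act g⁻¹ β)) := by
  rcases pos_or_neg (D.roots_invariant g⁻¹ β h.1) with h1 | h1
  · have := length_gt_of_pos h h1; omega
  · exact h1

theorem pos_of_length_gt {β : D.V} {g : D.W} (h : D.IsPosRoot β)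
    (hl : D.length g < D.length (D.srefl β * g)) : D.IsPosRoot (D.act g⁻¹ β) := by
  rcases pos_or_neg (D.roots_invariant g⁻¹ β h.1) with h1 | h1
  · exact h1
  · have := length_lt_of_neg h h1; omega

theorem le_refl' (a : D.W) : D.bruhatLE a a := Relation.ReflTransGen.refl

theorem le_trans' {a b c : D.W} (h : D.bruhatLE a b) (h' : D.bruhatLE b c) : D.bruhatLE a c :=
  Relation.ReflTransGen.trans h h'

theorem edge_le {β : D.V} {g : D.W} (h : D.IsPosRoot β)
    (h' : D.IsPosRoot (D.act g⁻¹ β)) : D.bruhatLE g (D.srefl β * g) :=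
  Relation.ReflTransGen.single ⟨⟨β, h, rfl⟩, length_gt_of_pos h h'⟩

theorem lt_of_neg {β : D.V} {g : D.W} (h : D.IsPosRoot β)
    (h' : D.IsPosRoot (-(D.act g⁻¹ β))) : D.bruhatLT (D.srefl β * g) g := by
  have hl := length_lt_of_neg h h'
  refine ⟨Relation.ReflTransGen.single ⟨⟨β, h, ?_⟩, hl⟩, ?_⟩
  · rw [← mul_assoc, srefl_mul_self h.1, one_mul]
  · intro h2; rw [h2] at hl; exact lt_irrefl _ hl

theorem length_of_le {a b : D.W} (h : D.bruhatLE a b) : a = b ∨ D.length a < D.length b := by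
  induction h with
  | refl => exact Or.inl rfl
  | tail _ h2 ih =>
    rcases ih with rfl | ih
    · exact Or.inr h2.2
    · exact Or.inr (ih.trans h2.2)

theorem le_antisymm' {a b : D.W} (h : D.bruhatLE a b) (h' : D.bruhatLE b a) : a = b := by
  rcases length_of_le h with h1 | h1
  · exact h1
  · rcases length_of_le h' with h2 | h2
    · exact h2.symm
    · omega

theorem neg_of_lt {β : D.V} {g : D.W} (h : D.IsPosRoot β)
    (h' : D.bruhatLT (D.srefl β * g) g) : D.IsPosRoot (-(D.act g⁻¹ β)) := by
  rcases length_of_le h'.1 with h1 | h1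
  · exact (h'.2 h1).elim
  · exact neg_of_length_lt h h1

/-- The lifting property. -/
theorem lifting (i : D.I) {x y : D.W} (h : D.bruhatLE x y) :
    D.bruhatLE x (D.s i * y) ∨ D.bruhatLE (D.s i * x) (D.s i * y) := by
  induction h with
  | refl => exact Or.inr (le_refl' _)
  | tail h1 h2 ih =>
    rename_i y y'
    obtain ⟨⟨β, hβ, rfl⟩, hl⟩ := h2
    rcases pos_dichotomy hβ i with h3 | h3
    · have h4 : D.bruhatLE (D.s i * y) (D.s i * (D.srefl β * y)) := by
        have h5 := edge_le (g := D.s i * y) h3 (by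
          rw [mul_inv_rev, s_inv, act_mul', ← act_mul' (D.s i), s_mul_self, act_one']
          exact pos_of_length_gt hβ hl)
        rw [srefl_conj _ hβ.1, s_inv] at h5
        simp only [mul_assoc] at h5
        rwa [s_mul_cancel] at h5
      rcases ih with ih | ih
      · exact Or.inl (le_trans' ih h4)
      · exact Or.inr (le_trans' ih h4)
    · left
      rw [h3, s_mul_cancel]
      exact h1

/-- `i` is a left ascent of `v`. -/
def Asc (v : D.W) (i : D.I) : Prop := D.IsPosRoot (D.act v⁻¹ (D.simple i))

theorem lift_asc {v y : D.W} {i : D.I} (hi : Asc v i) (h : D.bruhatLE v y) :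
    D.bruhatLE v (D.s i * y) := by
  rcases lifting i h with h1 | h1
  · exact h1
  · exact le_trans' (edge_le (pos_simple i) hi) h1

theorem lift_asc_word {v y : D.W} (l : List D.I) (hl : ∀ i ∈ l, Asc v i) (h : D.bruhatLE v y) :
    D.bruhatLE v (D.wordProd l * y) := by
  induction l with
  | nil => rwa [wordProd_nil, one_mul]
  | cons i l ih =>
    rw [wordProd_cons, mul_assoc]
    exact lift_asc (hl i (by simp)) (ih fun k hk => hl k (by simp [hk]))

theorem lift_down {z y : D.W} {i : D.I} (h : D.bruhatLE z (D.s i * y)) :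
    D.bruhatLE z y ∨ D.bruhatLE (D.s i * z) y := by
  have := lifting i h
  rwa [s_mul_cancel] at this

theorem lift_down_word {v : D.W} (l : List D.I) : ∀ {z : D.W}, D.bruhatLE z (D.wordProd l * v) →
    ∃ l' : List D.I, (∀ i ∈ l', i ∈ l) ∧ D.bruhatLE (D.wordProd l' * z) v := by
  induction l with
  | nil =>
    intro z h
    exact ⟨[], by simp, by simpa [wordProd_nil] using h⟩
  | cons i l ih =>
    intro z h
    rw [wordProd_cons, mul_assoc] at h
    rcases lift_down h with h1 | h1
    · obtain ⟨l', hl', h2⟩ := ih h1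
      exact ⟨l', fun k hk => by simp [hl' k hk], h2⟩
    · obtain ⟨l', hl', h2⟩ := ih h1
      refine ⟨l' ++ [i], ?_, ?_⟩
      · intro k hk
        rcases List.mem_append.mp hk with hk | hk
        · simp [hl' k hk]
        · simp at hk; simp [hk]
      · rw [wordProd_append, wordProd_cons, wordProd_nil, mul_one, mul_assoc]
        exact h2

/-- An element of `[v, xv]` with `x` a product of ascents of `v` is of the form `x'v`. -/
theorem interval_word {v z : D.W} (l : List D.I) (hl : ∀ i ∈ l, Asc v i)
    (hvz : D.bruhatLE v z) (hz : D.bruhatLE z (D.wordProd l * v)) :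
    ∃ l' : List D.I, (∀ i ∈ l', Asc v i) ∧ z * v⁻¹ = D.wordProd l' := by
  obtain ⟨l', hl', h⟩ := lift_down_word l hz
  have h1 := lift_asc_word l' (fun i hi => hl i (hl' i hi)) hvz
  have h2 := le_antisymm' h1 h
  refine ⟨l'.reverse, fun i hi => hl i (hl' i (by simpa using hi)), ?_⟩
  rw [wordProd_reverse]
  conv_lhs => rw [h2]
  group

/-- The combinatorial core: for `u` a product of left ascents of `v`. -/
theorem core {v : D.W} (l : List D.I) (hl : ∀ i ∈ l, Asc v i) {β : D.V} (hβ : D.IsPosRoot β) :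
    (D.bruhatLE v (D.srefl β * (D.wordProd l * v)) ∧
      D.bruhatLT (D.srefl β * (D.wordProd l * v)) (D.wordProd l * v)) ↔
      D.bruhatLT (D.srefl β * D.wordProd l) (D.wordProd l) := by
  set u := D.wordProd l with hu
  have hconj : D.srefl (D.act u⁻¹ β) = u⁻¹ * D.srefl β * u := by
    rw [srefl_conj _ hβ.1, inv_inv]
  have hlr : ∀ i ∈ l.reverse, Asc v i := fun i hi => hl i (by simpa using hi)
  constructor
  · rintro ⟨h1, h2⟩
    apply lt_of_neg hβ
    have h3 := neg_of_lt hβ h2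
    rcases pos_or_neg (D.roots_invariant u⁻¹ β hβ.1) with h4 | h4
    · exfalso
      rw [mul_inv_rev, act_mul'] at h3
      have h5 := length_lt_of_neg h4 h3
      have h6 := lift_asc_word l.reverse hlr h1
      rw [wordProd_reverse, ← hu] at h6
      rw [hconj] at h5
      simp only [mul_assoc] at h5 h6
      rcases length_of_le h6 with h7 | h7
      · rw [← h7] at h5; exact lt_irrefl _ h5
      · omega
    · exact h4
  · intro h
    have h1 := neg_of_lt hβ h
    obtain ⟨j, hj, hjl⟩ := exchange l hβ h1
    have hle : ∀ i ∈ l.eraseIdx j, Asc v i := fun i hi => hl i (List.mem_of_mem_eraseIdx hi)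
    constructor
    · rw [← mul_assoc, hjl]
      exact lift_asc_word _ hle (le_refl' v)
    · apply lt_of_neg hβ
      rw [mul_inv_rev, act_mul']
      rcases pos_or_neg (D.roots_invariant v⁻¹ _ (D.roots_invariant u⁻¹ β hβ.1)) with h4 | h4
      · exfalso
        have h5 := length_lt_of_neg (g := v) h1 (by rwa [map_neg, neg_neg])
        have h6 := lift_asc_word (l.reverse) hlr (lift_asc_word _ hle (le_refl' v))
        rw [wordProd_reverse, ← hjl, ← hu] at h6
        have h8 : D.srefl (-(D.act u⁻¹ β)) = u⁻¹ * D.srefl β * u := by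
          rw [← hconj]
          have hr := D.roots_invariant u⁻¹ β hβ.1
          rw [← srefl_act_self hr, srefl_conj _ hr, srefl_mul_self hr, one_mul, srefl_inv hr]
        rw [h8] at h5
        simp only [mul_assoc] at h5 h6
        rcases length_of_le h6 with h7 | h7
        · rw [← h7] at h5; exact lt_irrefl _ h5
        · omega
      · exact h4

/-! ### Minuscule words -/

/-- `l` is a minuscule word starting from the weight `μ`. -/
def MW (μ : D.V) : List D.I → Prop
  | [] => True
  | i :: l => D.coroot (D.simple i) (D.act (D.wordProd l) μ) = 1 ∧ MW μ l

theorem MW_of_get (μ : D.V) (l : List D.I) (h : ∀ k : Fin l.length,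
      D.coroot (D.simple (l.get k)) (D.act (D.wordProd (l.drop (k.val + 1))) μ) = 1) :
    MW μ l := by
  induction l with
  | nil => trivial
  | cons i l ih =>
    refine ⟨h ⟨0, by simp⟩, ih fun k => ?_⟩
    exact h k.succ

/-- intrinsic characterization of minuscule elements -/
def Minus (μ : D.V) (g : D.W) : Prop :=
  ∀ (h : D.W) (j : D.I), D.IsPosRoot (D.act h (D.simple j)) →
    D.IsPosRoot (-(D.act g⁻¹ (D.act h (D.simple j)))) →
    D.coroot (D.act h (D.simple j)) (D.act g μ) = -1

theorem real_pos_neg {h : D.W} {j i : D.I} (hp : D.IsPosRoot (D.act h (D.simple j)))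
    (hn : ¬ D.IsPosRoot (D.act (D.s i) (D.act h (D.simple j)))) :
    D.act h (D.simple j) = D.simple i := by
  have hr := D.roots_invariant (D.s i) _ hp.1
  obtain ⟨c, hc0, hc⟩ := pos_neg_multiple hp ((pos_or_neg hr).resolve_left hn)
  have hcq : (c : ℚ) ≠ 0 := by exact_mod_cast hc0
  have h1 : D.act h⁻¹ (D.simple i) = (c : ℚ)⁻¹ • D.simple j := by
    have h2 := congrArg (D.act h⁻¹) hc
    rw [act_inv_act, map_smul] at h2
    rw [h2, smul_smul, inv_mul_cancel₀ hcq, one_smul]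
  have hr' := D.roots_invariant h⁻¹ _ (D.simple_mem i)
  have h3 := D.posCoeff_spec _ hr' ⟨Pi.single j (c : ℚ)⁻¹, by
    intro k
    by_cases hk : k = j
    · subst hk; simp
    · simp [Pi.single_eq_of_ne hk], by rw [h1, ← single_sum]⟩
  rw [h1, single_sum] at h3
  have h4 := congrFun (coord_eq h3) j
  simp only [Pi.single_eq_same] at h4
  rw [h1] at hr'
  set n := D.posCoeff ((∑ k, (Pi.single j (c : ℚ)⁻¹ : D.I → ℚ) k • D.simple k)) j
  have h5 : (c : ℚ) * n = 1 := by rw [← h4]; exact mul_inv_cancel₀ hcq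
  have h6 : c * n = 1 := by exact_mod_cast h5
  have h7 : c = 1 := Nat.eq_one_of_mul_eq_one_right h6
  rw [hc, h7]; simp

theorem coroot_s_swap (i : D.I) {β : D.V} (hβ : β ∈ D.roots) (x : D.V) :
    D.coroot β (D.act (D.s i) x) = D.coroot (D.act (D.s i) β) x := by
  rw [← D.coroot_equivariant (D.s i) β hβ, ← act_mul', s_mul_self, act_one']

theorem coroot_simple_s (i : D.I) (x : D.V) :
    D.coroot (D.simple i) (D.act (D.s i) x) = - D.coroot (D.simple i) x := by
  rw [s_apply, map_sub, map_smul, D.coroot_self _ (D.simple_mem i), smul_eq_mul]; ring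

theorem act_s_s (i : D.I) (x : D.V) : D.act (D.s i) (D.act (D.s i) x) = x := by
  rw [← act_mul', s_mul_self, act_one']

theorem Minus_of_MW (μ : D.V) (l : List D.I) (hl : MW μ l) : Minus μ (D.wordProd l) := by
  induction l with
  | nil =>
    intro h j hp hn
    rw [wordProd_nil, inv_one, act_one'] at hn
    exact (not_pos_neg hp hn).elim
  | cons i l ih =>
    intro h j hp hn
    rw [wordProd_cons, act_mul']
    by_cases hq : D.IsPosRoot (D.act (D.s i) (D.act h (D.simple j)))
    · rw [coroot_s_swap i hp.1, ← act_mul']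
      rw [← act_mul'] at hq
      apply ih hl.2 _ _ hq
      rw [wordProd_cons, mul_inv_rev, s_inv, act_mul', ← act_mul' (D.s i)] at hn
      exact hn
    · rw [real_pos_neg hp hq, coroot_simple_s, hl.1]

/-- stripping a left descent -/
theorem Minus_strip {μ : D.V} {g : D.W} {i : D.I} (hm : Minus μ (D.s i * g)) (hi : Asc g i) :
    D.coroot (D.simple i) (D.act g μ) = 1 ∧ Minus μ g := by
  constructor
  · have h1 := hm 1 i (by rw [act_one']; exact pos_simple i) (by
      rw [act_one', mul_inv_rev, s_inv, act_mul', s_apply, D.coroot_self _ (D.simple_mem i)]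
      have : D.simple i - (2 : ℚ) • D.simple i = - D.simple i := by module
      rw [this, map_neg, neg_neg]
      exact hi)
    rw [act_one', act_mul', coroot_simple_s] at h1
    linarith
  · intro h j hp hn
    have hq : D.IsPosRoot (D.act (D.s i) (D.act h (D.simple j))) := by
      by_contra hq
      rw [real_pos_neg hp hq] at hn
      exact not_pos_neg hi hn
    rw [← act_mul'] at hq
    have h1 := hm (D.s i * h) j hq (by
      rw [mul_inv_rev, s_inv, act_mul', act_mul', act_s_s]
      exact hn)
    rw [act_mul', act_mul', D.coroot_equivariant (D.s i) _ hp.1] at h1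
    exact h1

theorem asc_of_reduced {i : D.I} {l : List D.I} {g : D.W} (h : D.IsReduced (i :: l) g) :
    Asc (D.wordProd l) i := by
  rcases pos_or_neg (D.roots_invariant (D.wordProd l)⁻¹ _ (D.simple_mem i)) with h1 | h1
  · exact h1
  · exfalso
    have h2 := length_lt_of_neg (pos_simple i) h1
    have h3 : D.length (D.srefl (D.simple i) * D.wordProd l) = l.length + 1 := by
      have := h.2
      rw [← h.1, wordProd_cons] at this
      rw [← List.length_cons (a := i), this]; rfl
    have := length_le l
    omega

theorem reduced_tail {i : D.I} {l : List D.I} {g : D.W} (h : D.IsReduced (i :: l) g) :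
    D.IsReduced l (D.wordProd l) := by
  refine ⟨rfl, le_antisymm ?_ (length_le l)⟩
  obtain ⟨l', hl', hlen⟩ := exists_reduced (D.wordProd l)
  have h1 := length_le (i :: l')
  rw [wordProd_cons, hl', ← wordProd_cons, h.1, ← h.2] at h1
  simp at h1
  omega

theorem MW_of_Minus (μ : D.V) (l : List D.I) : ∀ {g : D.W}, D.IsReduced l g → Minus μ g →
    MW μ l := by
  induction l with
  | nil => intros; trivial
  | cons i l ih =>
    intro g h hm
    rw [← h.1, wordProd_cons] at hm
    obtain ⟨h1, h2⟩ := Minus_strip hm (asc_of_reduced h)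
    exact ⟨h1, ih (reduced_tail h) h2⟩

/-- along a minuscule word the weight changes by the sum of the simple roots -/
theorem MW_weight {μ : D.V} (l : List D.I) (h : MW μ l) :
    D.act (D.wordProd l) μ = μ - (l.map D.simple).sum := by
  induction l with
  | nil => simp [wordProd_nil]
  | cons i l ih =>
    rw [wordProd_cons, act_mul', s_apply, h.1, ih h.2]
    simp only [List.map_cons, List.sum_cons]
    module

theorem MW_append {μ : D.V} (a b : List D.I) :
    MW μ (a ++ b) ↔ MW (D.act (D.wordProd b) μ) a ∧ MW μ b := by
  induction a with
  | nil => simp [MW]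
  | cons i a ih =>
    simp only [List.cons_append, MW, ih, wordProd_append, act_mul', and_assoc]

theorem offdiag {i k : D.I} (h : k ≠ i) : D.coroot (D.simple i) (D.simple k) ≤ 0 := by
  by_contra hc
  push Not at hc
  have hr := D.roots_invariant (D.s i) _ (D.simple_mem k)
  rw [s_apply] at hr
  have key : ∀ (e : ℚ) (c : D.I → ℚ), e • (D.simple k - D.coroot (D.simple i) (D.simple k) •
      D.simple i) = ∑ m, c m • D.simple m →
      c k = e ∧ c i = - e * D.coroot (D.simple i) (D.simple k) := by
    intro e c hce
    have h0 : ∑ m, c m • D.simple m = ∑ m, (Pi.single k e +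
        Pi.single i (- e * D.coroot (D.simple i) (D.simple k)) : D.I → ℚ) m • D.simple m := by
      simp only [Pi.add_apply, add_smul, Finset.sum_add_distrib]
      rw [← single_sum, ← single_sum, ← hce]
      module
    have h1 := coord_eq h0
    refine ⟨?_, ?_⟩
    · rw [congrFun h1 k]; simp [h]
    · rw [congrFun h1 i]; simp [Ne.symm h]
  rcases D.root_pos_or_neg _ hr with ⟨c, hc0, hce⟩ | ⟨c, hc0, hce⟩
  · obtain ⟨_, h2⟩ := key 1 c (by rw [one_smul]; exact hce)
    have := hc0 i
    linarith
  · obtain ⟨h2, _⟩ := key (-1) c (by rw [neg_one_smul]; exact hce)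
    have := hc0 k
    linarith

theorem sum_zero {i : D.I} (l : List D.I) (hi : i ∉ l) :
    D.coroot (D.simple i) (l.map D.simple).sum ≤ 0 ∧
    (D.coroot (D.simple i) (l.map D.simple).sum = 0 →
      ∀ k ∈ l, D.coroot (D.simple i) (D.simple k) = 0) := by
  induction l with
  | nil => simp
  | cons k l ih =>
    simp only [List.mem_cons, not_or] at hi
    obtain ⟨h1, h2⟩ := ih hi.2
    have h3 := offdiag (D := D) (Ne.symm hi.1)
    simp only [List.map_cons, List.sum_cons, map_add]
    refine ⟨by linarith, fun h4 m hm => ?_⟩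
    rcases List.mem_cons.mp hm with rfl | hm
    · linarith
    · exact h2 (by linarith) m hm

theorem s_comm {i k : D.I} (h : D.coroot (D.simple i) (D.simple k) = 0)
    (h' : D.coroot (D.simple k) (D.simple i) = 0) : D.s i * D.s k = D.s k * D.s i := by
  apply act_ext
  intro x
  simp only [act_mul', s_apply, map_sub, map_smul, h, h', smul_eq_mul]
  module

theorem word_comm {i : D.I} (l : List D.I)
    (h : ∀ k ∈ l, D.coroot (D.simple i) (D.simple k) = 0)
    (h' : ∀ k ∈ l, D.coroot (D.simple k) (D.simple i) = 0) :
    D.s i * D.wordProd l = D.wordProd l * D.s i := by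
  induction l with
  | nil => simp [wordProd_nil]
  | cons k l ih =>
    rw [wordProd_cons, ← mul_assoc, s_comm (h k (by simp)) (h' k (by simp)), mul_assoc,
      ih (fun m hm => h m (by simp [hm])) (fun m hm => h' m (by simp [hm])), mul_assoc]

theorem MW_comm {i : D.I} {μ : D.V} (l : List D.I)
    (h : ∀ k ∈ l, D.coroot (D.simple i) (D.simple k) = 0)
    (h' : ∀ k ∈ l, D.coroot (D.simple k) (D.simple i) = 0) (hm : MW μ l) :
    MW (D.act (D.s i) μ) l := by
  induction l with
  | nil => trivial
  | cons k l ih =>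
    have hl : ∀ m ∈ l, D.coroot (D.simple i) (D.simple m) = 0 := fun m hm => h m (by simp [hm])
    have hl' : ∀ m ∈ l, D.coroot (D.simple m) (D.simple i) = 0 := fun m hm => h' m (by simp [hm])
    refine ⟨?_, ih hl hl' hm.2⟩
    rw [← act_mul', ← word_comm l hl hl', act_mul', s_apply, map_sub, map_smul,
      h' k (by simp), hm.1]
    simp

theorem exists_last {i : D.I} (l : List D.I) (h : i ∈ l) :
    ∃ a b : List D.I, l = a ++ i :: b ∧ i ∉ b := by
  induction l with
  | nil => simp at h
  | cons k l ih =>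
    by_cases hi : i ∈ l
    · obtain ⟨a, b, rfl, hb⟩ := ih hi
      exact ⟨k :: a, b, rfl, hb⟩
    · rcases List.mem_cons.mp h with rfl | h
      · exact ⟨[], l, rfl, hi⟩
      · exact (hi h).elim

/-- For minuscule elements Bruhat order implies weak order. -/
theorem bruhat_weak (hsl : D.SimplyLaced) {π : D.V} (lw : List D.I) (hlw : MW π lw) :
    ∀ {v : D.W}, Minus π v → D.bruhatLE v (D.wordProd lw) →
      ∃ l : List D.I, D.wordProd lw = D.wordProd l * v ∧ MW (D.act v π) l := by
  induction lw with
  | nil =>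
    intro v _ hle
    rw [wordProd_nil] at hle ⊢
    have h1 : D.length (1 : D.W) = 0 := by
      have := length_le (D := D) []
      rw [wordProd_nil] at this
      simpa using this
    rcases length_of_le hle with h2 | h2
    · exact ⟨[], by rw [h2, wordProd_nil, one_mul], trivial⟩
    · omega
  | cons i lw ih =>
    intro v hv hle
    rw [wordProd_cons] at hle ⊢
    have hcase : D.bruhatLE v (D.wordProd lw) ∨
        (Asc (D.s i * v) i ∧ D.bruhatLE (D.s i * v) (D.wordProd lw)) := by
      rcases lift_down hle with h1 | h1
      · exact Or.inl h1
      · rcases pos_or_neg (D.roots_invariant v⁻¹ _ (D.simple_mem i)) with h2 | h2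
        · exact Or.inl (le_trans' (edge_le (pos_simple i) h2) h1)
        · refine Or.inr ⟨?_, h1⟩
          unfold Asc
          rw [mul_inv_rev, s_inv, act_mul', s_apply, D.coroot_self _ (D.simple_mem i)]
          have : D.simple i - (2 : ℚ) • D.simple i = - D.simple i := by module
          rw [this, map_neg]
          exact h2
    rcases hcase with h1 | ⟨h1, h2⟩
    · obtain ⟨l, hl, hml⟩ := ih hlw.2 hv h1
      refine ⟨i :: l, by rw [hl, wordProd_cons, mul_assoc], ?_, hml⟩
      rw [← act_mul', ← hl]
      exact hlw.1
    · obtain ⟨h3, h4⟩ := Minus_strip (g := D.s i * v) (by rwa [s_mul_cancel]) h1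
      obtain ⟨l, hl, hml⟩ := ih hlw.2 h4 h2
      have hvμ : D.act v π = D.act (D.s i) (D.act (D.s i * v) π) := by
        rw [← act_mul', s_mul_cancel]
      have hi1 := hlw.1
      rw [hl, act_mul'] at hi1
      have zero : ∀ b : List D.I, i ∉ b → MW (D.act (D.s i * v) π) b →
          D.coroot (D.simple i) (D.act (D.wordProd b) (D.act (D.s i * v) π)) = 1 →
          (∀ k ∈ b, D.coroot (D.simple i) (D.simple k) = 0) ∧
          (∀ k ∈ b, D.coroot (D.simple k) (D.simple i) = 0) := by
        intro b hb hmb h5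
        rw [MW_weight b hmb, map_sub, h3] at h5
        have h6 := (sum_zero b hb).2 (by linarith)
        exact ⟨h6, fun k hk => by rw [hsl]; exact h6 k hk⟩
      by_cases hil : i ∈ l
      · obtain ⟨a, b, rfl, hb⟩ := exists_last l hil
        rw [MW_append] at hml
        obtain ⟨hma, hib, hmb⟩ := hml
        obtain ⟨z1, z2⟩ := zero b hb hmb hib
        have hprod : D.wordProd (i :: b) * (D.s i * v) = D.wordProd b * v := by
          rw [wordProd_cons, word_comm b z1 z2, mul_assoc, s_mul_cancel]
        have hfull : D.wordProd lw = D.wordProd (a ++ b) * v := by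
          rw [hl, wordProd_append, mul_assoc, hprod, wordProd_append, mul_assoc]
        refine ⟨i :: (a ++ b), by rw [hfull, wordProd_cons, mul_assoc], ?_, ?_⟩
        · rw [← act_mul', ← hfull]; exact hlw.1
        · rw [MW_append]
          refine ⟨?_, ?_⟩
          · rw [← act_mul', hprod, act_mul'] at hma
            exact hma
          · rw [hvμ]; exact MW_comm b z1 z2 hmb
      · obtain ⟨z1, z2⟩ := zero l hil hml hi1
        refine ⟨l, ?_, ?_⟩
        · rw [hl, ← mul_assoc, word_comm l z1 z2, mul_assoc, s_mul_cancel]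
        · rw [hvμ]; exact MW_comm l z1 z2 hml

/-- Letters of a word which is minuscule both from `μ` and from a dominant weight. -/
theorem letters_dominant {μ π' : D.V} (hd : D.IsDominant π') (l : List D.I) (h : MW μ l)
    (h' : MW π' l) : ∀ i ∈ l, 0 ≤ D.coroot (D.simple i) μ := by
  induction l with
  | nil => simp
  | cons k l ih =>
    intro i hi
    rcases List.mem_cons.mp hi with rfl | hi
    · have h1 := h.1
      have h2 := h'.1
      rw [MW_weight l h.2, map_sub] at h1
      rw [MW_weight l h'.2, map_sub] at h2
      have := hd.2 i
      linarith
    · exact ih h.2 h'.2 i hi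

end Aux

end WeylSetting


open WeylSetting

/-- For a simply-laced Weyl group and `π`-minuscule `v ≤ w` in `W^P` with
`w v⁻¹` `π'`-minuscule for some dominant `π'`, for every `z ∈ [v,w]^P`:
`S(z/v) = S(z v⁻¹)`, i.e. for a positive root `β`,
`v ≤ s_β z < z` iff `s_β (z v⁻¹) < z v⁻¹`. -/
theorem skew_inversions_eq
    (D : WeylSetting) (hsl : D.SimplyLaced)
    (pi : D.V) (hpi : D.IsDominant pi)
    (v w : D.W) (hv : D.IsMinuscule pi v) (hw : D.IsMinuscule pi w)
    (hvr : D.IsMinRep (D.stab pi) v) (hwr : D.IsMinRep (D.stab pi) w)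
    (hvw : D.bruhatLE v w)
    (hmin : ∃ pi' : D.V, D.IsDominant pi' ∧ D.IsMinuscule pi' (w * v⁻¹))
    (z : D.W) (hz : D.IsMinRep (D.stab pi) z)
    (hvz : D.bruhatLE v z) (hzw : D.bruhatLE z w) :
    ∀ β : D.V, D.IsPosRoot β →
      ((D.bruhatLE v (D.srefl β * z) ∧ D.bruhatLT (D.srefl β * z) z) ↔
        D.bruhatLT (D.srefl β * (z * v⁻¹)) (z * v⁻¹)) := by
  intro β hβ
  obtain ⟨lv, hlv, hmv⟩ := hv
  obtain ⟨lw, hlw, hmw⟩ := hw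
  obtain ⟨pi', hd, l0, hl0, hm0⟩ := hmin
  have hMv : Minus pi v := hlv.1 ▸ Minus_of_MW pi lv (MW_of_get pi lv hmv)
  have hMw := MW_of_get pi lw hmw
  have hM0 := MW_of_get pi' l0 hm0
  obtain ⟨l, hl, hml⟩ := bruhat_weak hsl lw hMw hMv (by rw [hlw.1]; exact hvw)
  rw [hlw.1] at hl
  have hgl : w * v⁻¹ = D.wordProd l := by rw [hl]; group
  have hMg : Minus (D.act v pi) (w * v⁻¹) := hgl ▸ Minus_of_MW _ l hml
  have hM1 := MW_of_Minus _ l0 hl0 hMg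
  have hasc : ∀ i ∈ l0, Asc v i := by
    intro i hi
    rcases pos_or_neg (D.roots_invariant v⁻¹ _ (D.simple_mem i)) with h1 | h1
    · exact h1
    · exfalso
      have h2 := hMv 1 i (by rw [act_one']; exact pos_simple i) (by rw [act_one']; exact h1)
      rw [act_one'] at h2
      have h3 := letters_dominant hd l0 hM1 hM0 i hi
      linarith
  have hw0 : w = D.wordProd l0 * v := by rw [hl0.1]; group
  obtain ⟨l', hl', hz'⟩ := interval_word l0 hasc hvz (hw0 ▸ hzw)
  have hz0 : z = D.wordProd l' * v := by rw [← hz']; group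
  rw [hz', hz0]
  exact core l' hl' hβ
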